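/- Suppose q0 is a probability distribution on X with full support that minimizes the dissipation functional W_d over all probability distributions on X. Then for every probability distribution r0 on X, with r1 = r0P and q1 = q0P, the incorrect prior dissipation equals the expected Kullback–Leibler divergence between the Bayesian posteriors: W_d(r0) − W_d(q0) = Σ_{x1 : r1(x1)>0} r1(x1) Σ_{x0} r(x0|x1) ln( r(x0|x1) / q(x0|x1) ), where r(x0|x1) = r0(x0)P(x1|x0)/r1(x1) and q(x0|x1) = q0(x0)P(x1|x0)/q1(x1), with the convention that terms with r(x0|x1) = 0 are 0. -/

import Mathlib

open Finset

/-- `p` is a probability distribution on the finite set `X`. -/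
def IsProb {X : Type*} [Fintype X] (p : X → ℝ) : Prop :=
  (∀ x, 0 ≤ p x) ∧ ∑ x, p x = 1

/-- `P` is a row-stochastic kernel on `X`; `P x0 x1` denotes `P(x1|x0)`. -/
def IsKernel {X : Type*} [Fintype X] (P : X → X → ℝ) : Prop :=
  (∀ x0 x1, 0 ≤ P x0 x1) ∧ ∀ x0, ∑ x1, P x0 x1 = 1

/-- Push-forward of `p` under the kernel `P`: `(pP)(x1) = Σ_{x0} p(x0) P(x1|x0)`. -/
def push {X : Type*} [Fintype X] (P : X → X → ℝ) (p : X → ℝ) : X → ℝ :=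
  fun x1 => ∑ x0, p x0 * P x0 x1

/-- Shannon entropy with natural logarithm (`Real.log 0 = 0` gives the `0 ln 0 = 0` convention). -/
noncomputable def shannon {X : Type*} [Fintype X] (p : X → ℝ) : ℝ :=
  -∑ x, p x * Real.log (p x)

/-- Dissipation functional `W_d(p) = S(pP) − S(p) − Σ_x p(x) Q(x)`. -/
noncomputable def Wd {X : Type*} [Fintype X] (P : X → X → ℝ) (Q : X → ℝ) (p : X → ℝ) : ℝ :=
  shannon (push P p) - shannon p - ∑ x, p x * Q x

/-- Kullback–Leibler divergence `D(r‖q) = Σ_x r(x) ln(r(x)/q(x))`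
(terms with `r x = 0` vanish since `0 * log _ = 0`). -/
noncomputable def KL {X : Type*} [Fintype X] (r q : X → ℝ) : ℝ :=
  ∑ x, r x * Real.log (r x / q x)

theorem push_add_smul {X : Type*} [Fintype X] (P : X → X → ℝ) (p d : X → ℝ) (t : ℝ) :
    push P (fun x => p x + t * d x) = fun x => push P p x + t * push P d x := by
  funext x
  simp only [push, Finset.mul_sum, ← Finset.sum_add_distrib]
  exact Finset.sum_congr rfl fun _ _ => by ring

theorem push_sub {X : Type*} [Fintype X] (P : X → X → ℝ) (p q : X → ℝ) (x : X) :
    push P (fun y => p y - q y) x = push P p x - push P q x := by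
  simp only [push, sub_mul, Finset.sum_sub_distrib]

theorem sum_push_mul {X : Type*} [Fintype X] (P : X → X → ℝ) (p f : X → ℝ) :
    ∑ x1, push P p x1 * f x1 = ∑ x1, ∑ x0, p x0 * P x0 x1 * f x1 := by
  simp only [push, Finset.sum_mul]

theorem IsKernel.sum_mul {X : Type*} [Fintype X] {P : X → X → ℝ} (hP : IsKernel P)
    (p f : X → ℝ) : ∑ x1, ∑ x0, p x0 * P x0 x1 * f x0 = ∑ x0, p x0 * f x0 := by
  rw [Finset.sum_comm]
  refine Finset.sum_congr rfl fun x0 _ => ?_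
  have h : ∀ x1, p x0 * P x0 x1 * f x0 = p x0 * f x0 * P x0 x1 := fun _ => by ring
  simp only [h, ← Finset.mul_sum, hP.2, mul_one]

theorem IsKernel.sum_push {X : Type*} [Fintype X] {P : X → X → ℝ} (hP : IsKernel P)
    (p : X → ℝ) : ∑ x1, push P p x1 = ∑ x0, p x0 := by
  simpa [push] using hP.sum_mul p (fun _ => 1)

theorem IsKernel.push_nonneg {X : Type*} [Fintype X] {P : X → X → ℝ} (hP : IsKernel P)
    {p : X → ℝ} (hp : ∀ x, 0 ≤ p x) (x : X) : 0 ≤ push P p x :=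
  Finset.sum_nonneg fun y _ => mul_nonneg (hp y) (hP.1 y x)

theorem IsKernel.eq_zero_of_push_eq_zero {X : Type*} [Fintype X] {P : X → X → ℝ}
    (hP : IsKernel P) {p : X → ℝ} (hp : ∀ x, 0 ≤ p x) {x1 : X} (h : push P p x1 = 0) (x0 : X) :
    p x0 * P x0 x1 = 0 :=
  (Finset.sum_eq_zero_iff_of_nonneg fun y _ => mul_nonneg (hp y) (hP.1 y x1)).1 h x0
    (Finset.mem_univ x0)

/-- Derivative of Shannon entropy along a line; directions are required to vanish
where the base point does. -/
theorem hasDerivAt_shannon_line {X : Type*} [Fintype X] (p d : X → ℝ)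
    (h : ∀ x, p x = 0 → d x = 0) :
    HasDerivAt (fun t : ℝ => shannon fun x => p x + t * d x)
      (-∑ x, d x * (Real.log (p x) + 1)) 0 := by
  unfold shannon
  refine (HasDerivAt.fun_sum fun x _ => ?_).neg
  by_cases hx : p x = 0
  · simpa [hx, h x hx] using hasDerivAt_const (0 : ℝ) (0 : ℝ)
  · have hline : HasDerivAt (fun t : ℝ => p x + t * d x) (d x) 0 := by
      simpa using ((hasDerivAt_id (0 : ℝ)).mul_const (d x)).const_add (p x)
    have hlog : HasDerivAt (fun y : ℝ => y * Real.log y) (Real.log (p x) + 1)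
        (p x + 0 * d x) := by
      simpa using Real.hasDerivAt_mul_log hx
    rw [mul_comm]
    exact hlog.comp (0 : ℝ) hline

/-- First-order optimality condition for a full-support minimizer of the dissipation. -/
theorem stationary_of_isMin_Wd {X : Type*} [Fintype X] {P : X → X → ℝ} {Q : X → ℝ}
    (hP : IsKernel P) {q0 : X → ℝ} (hq : IsProb q0) (hqfull : ∀ x, 0 < q0 x)
    (hmin : ∀ p : X → ℝ, IsProb p → Wd P Q q0 ≤ Wd P Q p)
    {d : X → ℝ} (hd : ∑ x, d x = 0) :
    ∑ x, push P d x * Real.log (push P q0 x) = ∑ x, d x * Real.log (q0 x) - ∑ x, d x * Q x := by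
  have hpush : ∀ x, push P q0 x = 0 → push P d x = 0 := by
    intro x hx
    refine Finset.sum_eq_zero fun y _ => ?_
    have hPyx : P y x = 0 :=
      (mul_eq_zero.1 (hP.eq_zero_of_push_eq_zero hq.1 hx y)).resolve_left (hqfull y).ne'
    rw [hPyx, mul_zero]
  have hlin : HasDerivAt (fun t : ℝ => ∑ x, (q0 x + t * d x) * Q x) (∑ x, d x * Q x) 0 := by
    refine HasDerivAt.fun_sum fun x _ => HasDerivAt.mul_const ?_ (Q x)
    simpa using ((hasDerivAt_id (0 : ℝ)).mul_const (d x)).const_add (q0 x)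
  have hderiv := ((hasDerivAt_shannon_line (push P q0) (push P d) hpush).sub
    (hasDerivAt_shannon_line q0 d fun x hx => absurd hx (hqfull x).ne')).sub hlin
  have hloc : IsLocalMin (fun t : ℝ => Wd P Q fun x => q0 x + t * d x) 0 := by
    have hpos : ∀ᶠ t : ℝ in nhds 0, ∀ x, 0 < q0 x + t * d x := by
      refine Filter.eventually_all.2 fun x => ?_
      have hcont : ContinuousAt (fun t : ℝ => q0 x + t * d x) 0 := by fun_prop
      exact hcont.eventually (lt_mem_nhds (by simpa using hqfull x))
    filter_upwards [hpos] with t ht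
    have hprob : IsProb fun x => q0 x + t * d x :=
      ⟨fun x => (ht x).le, by
        rw [Finset.sum_add_distrib, ← Finset.mul_sum, hd, hq.2, mul_zero, add_zero]⟩
    simpa using hmin _ hprob
  simp only [Wd, push_add_smul] at hloc
  have hzero := hloc.hasDerivAt_eq_zero hderiv
  simp only [mul_add, mul_one, Finset.sum_add_distrib, hP.sum_push, hd] at hzero
  linarith

/-- The expected divergence between posteriors, as a double sum of joint log-ratios. -/
theorem sum_posterior_divergence {X : Type*} [Fintype X] {P : X → X → ℝ}
    (hP : IsKernel P) {q0 r0 : X → ℝ} (hqfull : ∀ x, 0 < q0 x) (hr : ∀ x, 0 ≤ r0 x) :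
    ∑ x1 ∈ Finset.univ.filter (fun x1 => 0 < push P r0 x1),
        push P r0 x1 *
          ∑ x0, (r0 x0 * P x0 x1 / push P r0 x1) *
            Real.log ((r0 x0 * P x0 x1 / push P r0 x1) /
              (q0 x0 * P x0 x1 / push P q0 x1)) =
      ∑ x, r0 x * Real.log (r0 x) - ∑ x, r0 x * Real.log (q0 x)
        - ∑ x, push P r0 x * Real.log (push P r0 x)
        + ∑ x, push P r0 x * Real.log (push P q0 x) := by
  rw [sum_push_mul, sum_push_mul, ← hP.sum_mul r0 (fun x => Real.log (r0 x)),
    ← hP.sum_mul r0 (fun x => Real.log (q0 x)), Finset.sum_filter]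
  simp only [← Finset.sum_sub_distrib, ← Finset.sum_add_distrib]
  refine Finset.sum_congr rfl fun x1 _ => ?_
  split_ifs with h1
  · rw [Finset.mul_sum]
    refine Finset.sum_congr rfl fun x0 _ => ?_
    by_cases h : r0 x0 * P x0 x1 = 0
    · simp [h]
    · obtain ⟨hr0, hP0⟩ := mul_ne_zero_iff.1 h
      have hq0 := (hqfull x0).ne'
      have hq1 : push P q0 x1 ≠ 0 := fun hz =>
        mul_ne_zero hq0 hP0 (hP.eq_zero_of_push_eq_zero (fun x => (hqfull x).le) hz x0)
      rw [Real.log_div (div_ne_zero h h1.ne') (div_ne_zero (mul_ne_zero hq0 hP0) hq1),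
        Real.log_div h h1.ne', Real.log_div (mul_ne_zero hq0 hP0) hq1,
        Real.log_mul hr0 hP0, Real.log_mul hq0 hP0]
      have hr1 := h1.ne'
      field_simp
      ring
  · have hz : push P r0 x1 = 0 := le_antisymm (not_lt.1 h1) (hP.push_nonneg hr x1)
    exact (Finset.sum_eq_zero fun x0 _ => by
      simp [hP.eq_zero_of_push_eq_zero hr hz x0]).symm

/-- For a full-support minimizer `q0` of the dissipation functional, the
incorrect prior dissipation equals the expected KL divergence between the Bayesian
posteriors. -/
theorem incorrect_prior_dissipation_eq_posterior_divergence {X : Type*} [Fintype X] [Nonempty X]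
    (P : X → X → ℝ) (Q : X → ℝ) (hP : IsKernel P)
    (q0 : X → ℝ) (hq : IsProb q0) (hqfull : ∀ x, 0 < q0 x)
    (hmin : ∀ p : X → ℝ, IsProb p → Wd P Q q0 ≤ Wd P Q p)
    (r0 : X → ℝ) (hr : IsProb r0) :
    Wd P Q r0 - Wd P Q q0 =
      ∑ x1 ∈ Finset.univ.filter (fun x1 => 0 < push P r0 x1),
        push P r0 x1 *
          ∑ x0, (r0 x0 * P x0 x1 / push P r0 x1) *
            Real.log ((r0 x0 * P x0 x1 / push P r0 x1) /
              (q0 x0 * P x0 x1 / push P q0 x1)) := by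
  rw [sum_posterior_divergence hP hqfull hr.1]
  have hstat := stationary_of_isMin_Wd hP hq hqfull hmin (d := fun x => r0 x - q0 x)
    (by rw [Finset.sum_sub_distrib, hr.2, hq.2, sub_self])
  simp only [push_sub, sub_mul, Finset.sum_sub_distrib] at hstat
  simp only [Wd, shannon]
  linarith
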